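/- For every complex number s with Re(s) > 2, one has Z_15(s) = (15/2)·Z_14(s) − (455/4)·Z_12(s) + (3003/2)·Z_10(s) − (109395/8)·Z_8(s) + (155155/2)·Z_6(s) − (943215/4)·Z_4(s) + (573405/2)·Z_2(s) − (929569/16)·Z_0(s). -/

import Mathlib

/-- The Euler–Zagier double zeta function `ζ(-c, s+c) = ∑_{m,n ≥ 1} m^c / (m+n)^(s+c)`. -/
noncomputable def Z (c : ℕ) (s : ℂ) : ℂ :=
  ∑' p : ℕ+ × ℕ+, ((p.1 : ℕ) : ℂ) ^ c / ((((p.1 : ℕ) + (p.2 : ℕ) : ℕ)) : ℂ) ^ (s + (c : ℂ))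

lemma doubleZeta_term_eq (c : ℕ) (s : ℂ) (p : ℕ+ × ℕ+) :
    ((p.1 : ℕ) : ℂ) ^ c / ((((p.1 : ℕ) + (p.2 : ℕ) : ℕ)) : ℂ) ^ (s + (c : ℂ)) =
      (((p.1 : ℕ) : ℂ) / (((p.1 : ℕ) + (p.2 : ℕ) : ℕ) : ℂ)) ^ c *
        ((((p.1 : ℕ) + (p.2 : ℕ) : ℕ) : ℂ) ^ s)⁻¹ := by
  have hN : (((p.1 : ℕ) + (p.2 : ℕ) : ℕ) : ℂ) ≠ 0 :=
    Nat.cast_ne_zero.2 (Nat.add_pos_left p.1.pos _).ne'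
  rw [Complex.cpow_add _ _ hN, Complex.cpow_natCast, div_pow, div_eq_mul_inv, div_eq_mul_inv,
    mul_inv]
  ring

lemma summable_pnat_add_rpow_inv {σ : ℝ} (hσ : 2 < σ) :
    Summable fun p : ℕ+ × ℕ+ => ((((p.1 : ℕ) + (p.2 : ℕ) : ℕ) : ℝ) ^ σ)⁻¹ := by
  have h1 : Summable fun n : ℕ+ => (((n : ℕ) : ℝ) ^ (σ / 2))⁻¹ :=
    (Real.summable_nat_rpow_inv.2 (by linarith : 1 < σ / 2)).comp_injective
      PNat.coe_injective
  refine Summable.of_nonneg_of_le (fun p => by positivity) (fun p => ?_)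
    (h1.mul_of_nonneg h1 (fun n => by positivity) (fun n => by positivity))
  have hm : (0 : ℝ) < (p.1 : ℕ) := Nat.cast_pos.2 p.1.pos
  have hn : (0 : ℝ) < (p.2 : ℕ) := Nat.cast_pos.2 p.2.pos
  rw [← mul_inv]
  push_cast
  refine inv_anti₀ (by positivity) ?_
  calc ((p.1 : ℕ) : ℝ) ^ (σ / 2) * ((p.2 : ℕ) : ℝ) ^ (σ / 2)
      ≤ (((p.1 : ℕ) : ℝ) + ((p.2 : ℕ) : ℝ)) ^ (σ / 2) *
        (((p.1 : ℕ) : ℝ) + ((p.2 : ℕ) : ℝ)) ^ (σ / 2) := by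
        gcongr <;> linarith
    _ = (((p.1 : ℕ) : ℝ) + ((p.2 : ℕ) : ℝ)) ^ σ := by
        rw [← Real.rpow_add (by positivity), add_halves]

lemma hasSum_Z (c : ℕ) {s : ℂ} (hs : 2 < s.re) :
    HasSum (fun p : ℕ+ × ℕ+ => (((p.1 : ℕ) : ℂ) / (((p.1 : ℕ) + (p.2 : ℕ) : ℕ) : ℂ)) ^ c *
      ((((p.1 : ℕ) + (p.2 : ℕ) : ℕ) : ℂ) ^ s)⁻¹) (Z c s) := by
  have h : Summable fun p : ℕ+ × ℕ+ =>
      (((p.1 : ℕ) : ℂ) / (((p.1 : ℕ) + (p.2 : ℕ) : ℕ) : ℂ)) ^ c *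
        ((((p.1 : ℕ) + (p.2 : ℕ) : ℕ) : ℂ) ^ s)⁻¹ := by
    refine Summable.of_norm_bounded (summable_pnat_add_rpow_inv hs) fun p => ?_
    have hN : 0 < (p.1 : ℕ) + (p.2 : ℕ) := Nat.add_pos_left p.1.pos _
    rw [norm_mul, norm_inv, Complex.norm_natCast_cpow_of_pos hN, norm_pow, norm_div,
      Complex.norm_natCast, Complex.norm_natCast]
    refine mul_le_of_le_one_left (by positivity) (pow_le_one₀ (by positivity) ?_)
    refine div_le_one_of_le₀ ?_ (by positivity)
    exact_mod_cast Nat.le_add_right _ _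
  have hZ : Z c s = ∑' p : ℕ+ × ℕ+,
      (((p.1 : ℕ) : ℂ) / (((p.1 : ℕ) + (p.2 : ℕ) : ℕ) : ℂ)) ^ c *
        ((((p.1 : ℕ) + (p.2 : ℕ) : ℕ) : ℂ) ^ s)⁻¹ :=
    tsum_congr (doubleZeta_term_eq c s)
  rw [hZ]
  exact h.hasSum

/-- A sum over pairs whose terms change sign under swapping the pair vanishes. -/
lemma HasSum.eq_zero_of_swap_neg {α : Type*} {f : α × α → ℂ} {a : ℂ} (hf : HasSum f a)
    (h : ∀ p : α × α, f p.swap = -f p) : a = 0 := by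
  have h1 : HasSum (fun p : α × α => f p.swap) a := (Equiv.prodComm α α).hasSum_iff.2 hf
  simp only [h] at h1
  exact self_eq_neg.1 (h1.unique hf.neg)

theorem zeta_neg_fifteen_relation (s : ℂ) (hs : 2 < s.re) :
    Z 15 s = (15 / 2) * Z 14 s - (455 / 4) * Z 12 s + (3003 / 2) * Z 10 s - (109395 / 8) * Z 8 s + (155155 / 2) * Z 6 s - (943215 / 4) * Z 4 s + (573405 / 2) * Z 2 s - (929569 / 16) * Z 0 s := by
  have H := fun c => hasSum_Z c hs
  refine sub_eq_zero.1 (((H 15).sub (((((((((H 14).mul_left (15 / 2)).sub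
    ((H 12).mul_left (455 / 4))).add ((H 10).mul_left (3003 / 2))).sub
    ((H 8).mul_left (109395 / 8))).add ((H 6).mul_left (155155 / 2))).sub
    ((H 4).mul_left (943215 / 4))).add ((H 2).mul_left (573405 / 2))).sub
    ((H 0).mul_left (929569 / 16)))).eq_zero_of_swap_neg fun p => ?_)
  have hN : (((p.1 : ℕ) + (p.2 : ℕ) : ℕ) : ℂ) ≠ 0 :=
    Nat.cast_ne_zero.2 (Nat.add_pos_left p.1.pos _).ne'
  have hxy : ((p.2 : ℕ) : ℂ) / (((p.1 : ℕ) + (p.2 : ℕ) : ℕ) : ℂ) =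
      1 - ((p.1 : ℕ) : ℂ) / (((p.1 : ℕ) + (p.2 : ℕ) : ℕ) : ℂ) := by
    rw [eq_sub_iff_add_eq, ← add_div, div_eq_one_iff_eq hN]
    push_cast
    ring
  simp only [Prod.fst_swap, Prod.snd_swap]
  rw [add_comm (p.2 : ℕ) (p.1 : ℕ), hxy]
  generalize ((p.1 : ℕ) : ℂ) / (((p.1 : ℕ) + (p.2 : ℕ) : ℕ) : ℂ) = x
  ring
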